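/- Let n = 4. The set 𝒯̃ satisfies: (1) 𝒯₂ ⊆ 𝒯̃ (with 𝒯₂ formed on ℝ⁴); (2) SPAN(𝒯̃) is closed under pointwise multiplication, i.e. if u, v ∈ SPAN(𝒯̃) then u·v ∈ SPAN(𝒯̃); (3) for every u ∈ 𝒯̃ and every i ∈ {1,2,3,4}, the partial derivative ∂u/∂x_i (taken on ℝ⁴∖{0}) belongs to SPAN(𝒯̃). -/

import Mathlib

open Real
open scoped BigOperators

noncomputable section

abbrev E (n : ℕ) := EuclideanSpace ℝ (Fin n)

/-- The Euclidean Laplacian of `f` at `x` (sum of second partial derivatives). -/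
def lap (n : ℕ) (f : E n → ℝ) (x : E n) : ℝ :=
  ∑ i : Fin n, fderiv ℝ (fun y => fderiv ℝ f y (EuclideanSpace.single i 1)) x
    (EuclideanSpace.single i 1)

/-- `f` is a (real) polynomial function on `ℝⁿ`. -/
def IsPolyFun (n : ℕ) (f : E n → ℝ) : Prop :=
  ∃ P : MvPolynomial (Fin n) ℝ, ∀ x : E n, f x = MvPolynomial.eval (fun i => x i) P

/-- `p` is a harmonic homogeneous polynomial of degree `m` on `ℝⁿ`. -/
def IsHHP (n m : ℕ) (p : E n → ℝ) : Prop :=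
  IsPolyFun n p ∧ (∀ (c : ℝ) (x : E n), p (c • x) = c ^ m * p x) ∧ ∀ x : E n, lap n p x = 0

/-- The set `𝒯₁` of leading harmonic terms `|x|^{2-n-2k} p(x)`, `k ≥ 1`. -/
def T1 (n : ℕ) : Set (E n → ℝ) :=
  {f | ∃ (k : ℕ) (p : E n → ℝ), 1 ≤ k ∧ IsHHP n k p ∧
    f = fun x => ‖x‖ ^ ((2:ℝ) - n - 2 * k) * p x}

/-- The set `𝒯₂` of functions `|x|^{(2-n)l-k-m} p(x)`, `k ≥ l ≥ 1`, `k ≥ m`, `k - m` even. -/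
def T2 (n : ℕ) : Set (E n → ℝ) :=
  {f | ∃ (l k m : ℕ) (p : E n → ℝ), IsHHP n m p ∧ 1 ≤ l ∧ l ≤ k ∧ m ≤ k ∧ Even (k - m) ∧
    f = fun x => ‖x‖ ^ (((2:ℝ) - n) * l - k - m) * p x}

/-- The set `𝒯` of functions `|x|^{σ-m} p(x)`, `σ = 2j - (n-2)l - k`,
`k ≥ l ≥ j+1`, `k ≥ m`, `k - m` even. -/
def Tset (n : ℕ) : Set (E n → ℝ) :=
  {f | ∃ (j l k m : ℕ) (p : E n → ℝ), IsHHP n m p ∧ j + 1 ≤ l ∧ l ≤ k ∧ m ≤ k ∧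
    Even (k - m) ∧
    f = fun x => ‖x‖ ^ ((2 * (j:ℝ) - ((n:ℝ) - 2) * l - k) - m) * p x}

/-- The set `𝒯̃` (on `ℝ⁴`) of functions `|x|^{-2l-k-m} (log|x|)^i p(x)`,
`l ≥ 1`, `k ≥ l + i`, `k ≥ m`, `k - m` even. -/
def Ttilde : Set (E 4 → ℝ) :=
  {f | ∃ (l k i m : ℕ) (p : E 4 → ℝ), IsHHP 4 m p ∧ 1 ≤ l ∧ l + i ≤ k ∧ m ≤ k ∧
    Even (k - m) ∧
    f = fun x => ‖x‖ ^ (-(2 * (l:ℝ)) - k - m) * (Real.log ‖x‖) ^ i * p x}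

namespace MvPolynomial

variable {σ : Type*} [Fintype σ]

/-- The formal Laplacian on polynomials. -/
def laplacian : MvPolynomial σ ℝ →ₗ[ℝ] MvPolynomial σ ℝ :=
  ∑ i, (pderiv i).toLinearMap ∘ₗ (pderiv i).toLinearMap

theorem laplacian_apply (P : MvPolynomial σ ℝ) :
    laplacian P = ∑ i, pderiv i (pderiv i P) := by
  simp [laplacian]

/-- The polynomial `|x|²`. -/
def normSq : MvPolynomial σ ℝ := ∑ i, X i ^ 2

theorem isHomogeneous_normSq : (normSq : MvPolynomial σ ℝ).IsHomogeneous 2 :=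
  IsHomogeneous.sum _ _ _ fun i _ => isHomogeneous_X_pow i 2

theorem pderiv_normSq (i : σ) : pderiv i (normSq : MvPolynomial σ ℝ) = 2 * X i := by
  classical
  simp [normSq, pderiv_X, Pi.single_apply]

theorem IsHomogeneous.laplacian {P : MvPolynomial σ ℝ} {d : ℕ} (hP : P.IsHomogeneous d) :
    (laplacian P).IsHomogeneous (d - 2) := by
  rw [laplacian_apply]
  exact IsHomogeneous.sum _ _ _ fun i _ => hP.pderiv.pderiv

theorem laplacian_eq_zero_of_isHomogeneous {P : MvPolynomial σ ℝ} {d : ℕ}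
    (hP : P.IsHomogeneous d) (hd : d ≤ 1) : laplacian P = 0 := by
  rw [laplacian_apply]
  refine Finset.sum_eq_zero fun i _ => ?_
  have h : (pderiv i P).IsHomogeneous 0 := by
    have := hP.pderiv (i := i)
    rwa [Nat.sub_eq_zero_of_le hd] at this
  rw [← totalDegree_zero_iff_isHomogeneous, totalDegree_eq_zero_iff_eq_C] at h
  rw [h, pderiv_C]

theorem laplacian_normSq_mul {P : MvPolynomial σ ℝ} {d : ℕ} (hP : P.IsHomogeneous d) :
    laplacian (normSq * P) =
      (2 * Fintype.card σ + 4 * d : ℝ) • P + normSq * laplacian P := by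
  have h (i : σ) : pderiv i (pderiv i (normSq * P)) =
      2 * P + 4 * (X i * pderiv i P) + normSq * pderiv i (pderiv i P) := by
    have h2 : pderiv i (2 : MvPolynomial σ ℝ) = 0 := pderiv_C (a := (2 : ℝ)) (i := i)
    simp only [pderiv_mul, map_add, pderiv_normSq, pderiv_X_self, h2]
    ring
  simp only [laplacian_apply, h, Finset.sum_add_distrib, ← Finset.mul_sum,
    hP.sum_X_mul_pderiv]
  simp only [Finset.sum_const, Finset.card_univ, smul_eq_C_mul, nsmul_eq_mul, map_add, map_mul,
    map_natCast, map_ofNat]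
  ring

theorem exists_laplacian_normSq_pow_mul [Nonempty σ] {P : MvPolynomial σ ℝ} {d : ℕ}
    (hP : P.IsHomogeneous d) (hΔ : laplacian P = 0) (j : ℕ) :
    ∃ c : ℝ, 0 < c ∧ laplacian (normSq ^ (j + 1) * P) = c • (normSq ^ j * P) := by
  have hcard : (0 : ℝ) < Fintype.card σ := by exact_mod_cast Fintype.card_pos
  induction j with
  | zero =>
    refine ⟨2 * Fintype.card σ + 4 * d, by positivity, ?_⟩
    simpa [hΔ] using laplacian_normSq_mul hP
  | succ j ih =>
    obtain ⟨c, hc, h⟩ := ih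
    refine ⟨2 * Fintype.card σ + 4 * (2 * (j + 1) + d : ℕ) + c, by positivity, ?_⟩
    rw [pow_succ' _ (j + 1), mul_assoc, laplacian_normSq_mul
      ((isHomogeneous_normSq.pow (j + 1)).mul hP), h, mul_smul_comm, ← mul_assoc,
      ← pow_succ', ← add_smul]

/-- The span of the polynomials `|x|^{2j} h` of degree `d` with `h` harmonic and homogeneous. -/
def almansi (σ : Type*) [Fintype σ] (d : ℕ) : Submodule ℝ (MvPolynomial σ ℝ) :=
  Submodule.span ℝ {q | ∃ (j m : ℕ) (h : MvPolynomial σ ℝ), 2 * j + m = d ∧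
    h.IsHomogeneous m ∧ laplacian h = 0 ∧ q = normSq ^ j * h}

theorem almansi_le_homogeneousSubmodule (d : ℕ) :
    almansi σ d ≤ homogeneousSubmodule σ ℝ d := by
  refine Submodule.span_le.2 ?_
  rintro _ ⟨j, m, h, rfl, hh, -, rfl⟩
  exact (isHomogeneous_normSq.pow j).mul hh

theorem exists_laplacian_eq_of_mem_almansi [Nonempty σ] {d : ℕ} {F : MvPolynomial σ ℝ}
    (hF : F ∈ almansi σ d) : ∃ G ∈ almansi σ (d + 2), laplacian G = F := by
  suffices almansi σ d ≤ (almansi σ (d + 2)).map laplacian from this hF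
  refine Submodule.span_le.2 ?_
  rintro _ ⟨j, m, h, rfl, hh, hΔ, rfl⟩
  obtain ⟨c, hc, e⟩ := exists_laplacian_normSq_pow_mul hh hΔ j
  refine ⟨c⁻¹ • (normSq ^ (j + 1) * h), Submodule.smul_mem _ _ (Submodule.subset_span
    ⟨j + 1, m, h, by ring, hh, hΔ, rfl⟩), ?_⟩
  rw [map_smul, e, inv_smul_smul₀ hc.ne']

theorem mem_almansi_of_laplacian_eq_zero {d : ℕ} {P : MvPolynomial σ ℝ}
    (hP : P.IsHomogeneous d) (hΔ : laplacian P = 0) : P ∈ almansi σ d :=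
  Submodule.subset_span ⟨0, d, P, by simp, hP, hΔ, by simp⟩

/-- Every homogeneous polynomial is a sum of terms `|x|^{2j} h` with `h` harmonic. -/
theorem IsHomogeneous.mem_almansi [Nonempty σ] {d : ℕ} {P : MvPolynomial σ ℝ}
    (hP : P.IsHomogeneous d) : P ∈ almansi σ d := by
  induction d using Nat.twoStepInduction generalizing P with
  | zero =>
    exact mem_almansi_of_laplacian_eq_zero hP
      (laplacian_eq_zero_of_isHomogeneous hP zero_le_one)
  | one =>
    exact mem_almansi_of_laplacian_eq_zero hP
      (laplacian_eq_zero_of_isHomogeneous hP le_rfl)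
  | more d ih _ =>
    obtain ⟨G, hG, e⟩ := exists_laplacian_eq_of_mem_almansi (ih hP.laplacian)
    rw [← sub_add_cancel P G]
    exact add_mem (mem_almansi_of_laplacian_eq_zero
      (hP.sub (almansi_le_homogeneousSubmodule _ hG)) (by rw [map_sub, e, sub_self])) hG

theorem IsHomogeneous.eval_smul {P : MvPolynomial σ ℝ} {d : ℕ} (hP : P.IsHomogeneous d)
    (c : ℝ) (x : σ → ℝ) : eval (c • x) P = c ^ d * eval x P := by
  simp only [eval_eq', Finset.mul_sum]
  refine Finset.sum_congr rfl fun s hs => ?_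
  have hd : ∑ i, s i = d := by
    rw [hP.degree_eq_sum_deg_support hs]
    exact (Finset.sum_subset (Finset.subset_univ _) (by simp)).symm
  simp only [Pi.smul_apply, smul_eq_mul, mul_pow, Finset.prod_mul_distrib,
    Finset.prod_pow_eq_pow_sum, hd]
  ring

theorem isHomogeneous_of_eval_smul {P : MvPolynomial σ ℝ} {m : ℕ}
    (hP : ∀ (c : ℝ) (x : σ → ℝ), eval (c • x) P = c ^ m * eval x P) : P.IsHomogeneous m := by
  let N := P.totalDegree + 1
  have hsum : ∑ d ∈ Finset.range N, ((2 : ℝ) ^ d - 2 ^ m) • homogeneousComponent d P = 0 := by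
    refine funext fun x => ?_
    have h := hP 2 x
    rw [← sum_homogeneousComponent P] at h
    simp only [map_sum, (homogeneousComponent_isHomogeneous _ P).eval_smul, Finset.mul_sum] at h
    simp only [map_sum, smul_eval, sub_mul, Finset.sum_sub_distrib, map_zero]
    exact sub_eq_zero.2 h
  have hzero (d : ℕ) (hd : d ≠ m) : homogeneousComponent d P = 0 := by
    by_cases hdN : d ∈ Finset.range N
    · have h := congrArg (homogeneousComponent d) hsum
      simp only [map_sum, map_smul, map_zero, homogeneousComponent_of_mem
        (homogeneousComponent_mem _ P), smul_ite, smul_zero] at h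
      rw [Finset.sum_ite_eq _ d, if_pos hdN, smul_eq_zero, sub_eq_zero] at h
      exact h.resolve_left fun h2 => hd (Nat.pow_right_injective le_rfl (by exact_mod_cast h2))
    · exact homogeneousComponent_eq_zero _ _ (by simpa [N] using hdN)
  rw [← sum_homogeneousComponent P]
  refine IsHomogeneous.sum _ _ _ fun d _ => ?_
  by_cases hd : d = m
  · exact hd ▸ homogeneousComponent_isHomogeneous d P
  · rw [hzero d hd]
    exact isHomogeneous_zero _ _ _

end MvPolynomial

open MvPolynomial

theorem hasFDerivAt_eval {n : ℕ} (P : MvPolynomial (Fin n) ℝ) (x : E n) :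
    HasFDerivAt (fun y : E n => eval (fun i => y i) P)
      (∑ i, eval (fun i => x i) (pderiv i P) • (EuclideanSpace.proj i : E n →L[ℝ] ℝ)) x := by
  classical
  induction P using MvPolynomial.induction_on with
  | C a => simpa using hasFDerivAt_const a x
  | add p q hp hq =>
    simp only [map_add, add_smul, Finset.sum_add_distrib]
    exact hp.add hq
  | mul_X p j hp =>
    have hj : HasFDerivAt (fun y : E n => y j) (EuclideanSpace.proj j : E n →L[ℝ] ℝ) x :=
      (EuclideanSpace.proj j : E n →L[ℝ] ℝ).hasFDerivAt
    simp only [map_mul, eval_X]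
    refine (hp.mul hj).congr_fderiv ?_
    ext v
    simp [pderiv_X, Pi.single_apply, add_mul, Finset.sum_add_distrib, Finset.mul_sum,
      apply_ite, mul_assoc]

theorem fderiv_eval_single {n : ℕ} (P : MvPolynomial (Fin n) ℝ) (x : E n) (i : Fin n) :
    fderiv ℝ (fun y : E n => eval (fun i => y i) P) x (EuclideanSpace.single i 1) =
      eval (fun i => x i) (pderiv i P) := by
  rw [(hasFDerivAt_eval P x).fderiv]
  simp

theorem lap_eval {n : ℕ} (P : MvPolynomial (Fin n) ℝ) (x : E n) :
    lap n (fun y : E n => eval (fun i => y i) P) x = eval (fun i => x i) (laplacian P) := by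
  simp only [lap, fderiv_eval_single, laplacian_apply, map_sum]

theorem isHHP_eval {n m : ℕ} {P : MvPolynomial (Fin n) ℝ} (hP : P.IsHomogeneous m)
    (hΔ : laplacian P = 0) : IsHHP n m (fun y : E n => eval (fun i => y i) P) :=
  ⟨⟨P, fun _ => rfl⟩, fun c x => hP.eval_smul c (fun i => x i), fun x => by
    rw [lap_eval, hΔ, map_zero]⟩

theorem IsHHP.exists_isHomogeneous {n m : ℕ} {p : E n → ℝ} (hp : IsHHP n m p) :
    ∃ P : MvPolynomial (Fin n) ℝ, P.IsHomogeneous m ∧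
      p = fun y : E n => eval (fun i => y i) P := by
  obtain ⟨⟨P, hP⟩, hhom, -⟩ := hp
  refine ⟨P, isHomogeneous_of_eval_smul fun c x => ?_, funext hP⟩
  have h := hhom c (WithLp.toLp 2 x)
  rw [hP, hP] at h
  exact h

theorem eval_normSq {n : ℕ} (x : E n) :
    eval (fun i => x i) (normSq : MvPolynomial (Fin n) ℝ) = ‖x‖ ^ 2 := by
  simp [normSq, EuclideanSpace.norm_sq_eq]

/-- The functions agreeing on `ℝ⁴∖{0}` with an element of the span of `𝒯̃`. -/
def TtildeSpan : Submodule ℝ (E 4 → ℝ) where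
  carrier := {f | ∃ w ∈ Submodule.span ℝ Ttilde, ∀ x : E 4, x ≠ 0 → f x = w x}
  zero_mem' := ⟨0, zero_mem _, fun _ _ => rfl⟩
  add_mem' := by
    rintro f g ⟨v, hv, hf⟩ ⟨w, hw, hg⟩
    exact ⟨v + w, add_mem hv hw, fun x hx => by simp [hf x hx, hg x hx]⟩
  smul_mem' := by
    rintro c f ⟨w, hw, hf⟩
    exact ⟨c • w, Submodule.smul_mem _ c hw, fun x hx => by simp [hf x hx]⟩

theorem TtildeSpan.congr {f g : E 4 → ℝ} (hf : f ∈ TtildeSpan) (h : ∀ x, x ≠ 0 → g x = f x) :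
    g ∈ TtildeSpan := by
  obtain ⟨w, hw, hfw⟩ := hf
  exact ⟨w, hw, fun x hx => (h x hx).trans (hfw x hx)⟩

/-- The function `|x|^a (log |x|)^i P(x)`. -/
def logTerm (a : ℝ) (i : ℕ) : MvPolynomial (Fin 4) ℝ →ₗ[ℝ] (E 4 → ℝ) where
  toFun P x := ‖x‖ ^ a * Real.log ‖x‖ ^ i * eval (fun i => x i) P
  map_add' P Q := by
    ext x
    simp [mul_add]
  map_smul' c P := by
    ext x
    simp [mul_left_comm]

theorem logTerm_apply (a : ℝ) (i : ℕ) (P : MvPolynomial (Fin 4) ℝ) (x : E 4) :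
    logTerm a i P x = ‖x‖ ^ a * Real.log ‖x‖ ^ i * eval (fun i => x i) P := rfl

/-- Homogeneous polynomials need not be harmonic for the corresponding term to lie in the span. -/
theorem logTerm_mem {l k i d : ℕ} {P : MvPolynomial (Fin 4) ℝ} (hP : P.IsHomogeneous d)
    (hl : 1 ≤ l) (hli : l + i ≤ k) (hd : d ≤ k) (he : Even (k - d)) {a : ℝ}
    (ha : a = -(2 * (l : ℝ)) - k - d) : logTerm a i P ∈ TtildeSpan := by
  suffices almansi (Fin 4) d ≤ TtildeSpan.comap (logTerm a i) from this hP.mem_almansi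
  refine Submodule.span_le.2 ?_
  rintro _ ⟨j, m, h, rfl, hh, hΔ, rfl⟩
  refine ⟨_, Submodule.subset_span ⟨l, k, i, m, _, isHHP_eval hh hΔ, hl, hli, by lia, ?_, rfl⟩,
    fun x hx => ?_⟩
  · obtain ⟨r, hr⟩ := he
    exact ⟨r + j, by lia⟩
  · have hx' : 0 < ‖x‖ := norm_pos_iff.2 hx
    have hpow : ‖x‖ ^ (-(2 * (l : ℝ)) - k - m) = ‖x‖ ^ a * (‖x‖ ^ 2) ^ j := by
      rw [← pow_mul, ← Real.rpow_natCast, ← Real.rpow_add hx', ha]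
      push_cast
      ring_nf
    rw [logTerm_apply, map_mul, map_pow, eval_normSq, hpow]
    ring

theorem Ttilde_mul_mem {u v : E 4 → ℝ} (hu : u ∈ Ttilde) (hv : v ∈ Ttilde) :
    u * v ∈ TtildeSpan := by
  obtain ⟨l, k, i, m, p, hp, hl, hli, hmk, he, rfl⟩ := hu
  obtain ⟨l', k', i', m', p', hp', hl', hli', hmk', he', rfl⟩ := hv
  obtain ⟨P, hP, rfl⟩ := hp.exists_isHomogeneous
  obtain ⟨P', hP', rfl⟩ := hp'.exists_isHomogeneous
  refine TtildeSpan.congr (logTerm_mem (l := l + l') (k := k + k') (i := i + i') (hP.mul hP')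
    (by lia) (by lia) (by lia) ?_ rfl) fun x hx => ?_
  · obtain ⟨r, hr⟩ := he
    obtain ⟨r', hr'⟩ := he'
    exact ⟨r + r', by lia⟩
  · have hpow : ‖x‖ ^ (-(2 * ((l + l' : ℕ) : ℝ)) - (k + k' : ℕ) - (m + m' : ℕ)) =
        ‖x‖ ^ (-(2 * (l : ℝ)) - k - m) * ‖x‖ ^ (-(2 * (l' : ℝ)) - k' - m') := by
      rw [← Real.rpow_add (norm_pos_iff.2 hx)]
      push_cast
      ring_nf
    rw [logTerm_apply, hpow, map_mul, Pi.mul_apply]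
    ring

theorem TtildeSpan_mul_mem {u v : E 4 → ℝ} (hu : u ∈ Submodule.span ℝ Ttilde)
    (hv : v ∈ Submodule.span ℝ Ttilde) : u * v ∈ TtildeSpan := by
  have h : Submodule.span ℝ Ttilde * Submodule.span ℝ Ttilde ≤ TtildeSpan := by
    rw [Submodule.span_mul_span, Submodule.span_le]
    rintro _ ⟨f, hf, g, hg, rfl⟩
    exact Ttilde_mul_mem hf hg
  exact h (Submodule.mul_mem_mul hu hv)

theorem hasFDerivAt_norm_of_ne_zero {n : ℕ} {x : E n} (hx : x ≠ 0) :
    HasFDerivAt (fun y : E n => ‖y‖) (‖x‖⁻¹ • innerSL ℝ x) x := by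
  have hx' : ‖x‖ ≠ 0 := norm_ne_zero_iff.2 hx
  have h := (hasStrictFDerivAt_norm_sq x).hasFDerivAt.sqrt (pow_ne_zero 2 hx')
  simp only [Real.sqrt_sq (norm_nonneg _)] at h
  refine h.congr_fderiv ?_
  ext v
  simp
  field_simp

theorem fderiv_logTerm (a : ℝ) (i : ℕ) (P : MvPolynomial (Fin 4) ℝ) {x : E 4} (hx : x ≠ 0)
    (s : Fin 4) :
    fderiv ℝ (logTerm a i P) x (EuclideanSpace.single s 1) =
      a * logTerm (a - 2) i (X s * P) x + i * logTerm (a - 2) (i - 1) (X s * P) x +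
        logTerm a i (pderiv s P) x := by
  have hx' : 0 < ‖x‖ := norm_pos_iff.2 hx
  have hn := hasFDerivAt_norm_of_ne_zero hx
  have h := ((hn.rpow_const (p := a) (Or.inl hx'.ne')).mul
    ((hn.log hx'.ne').pow i)).mul (hasFDerivAt_eval P x)
  have e : logTerm a i P =
    ((fun y : E 4 => ‖y‖ ^ a) * (fun y => Real.log ‖y‖ ^ i)) * fun y => eval (fun i => y i) P := rfl
  have h1 : ‖x‖ ^ (a - 1) = ‖x‖ ^ a * ‖x‖⁻¹ := by
    rw [Real.rpow_sub_one hx'.ne', div_eq_mul_inv]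
  have h2 : ‖x‖ ^ (a - 2) = ‖x‖ ^ a * ‖x‖⁻¹ * ‖x‖⁻¹ := by
    rw [show a - 2 = a - 1 - 1 by ring, Real.rpow_sub_one hx'.ne', h1, div_eq_mul_inv]
  rw [e, h.fderiv]
  simp [logTerm_apply, h1, h2, EuclideanSpace.inner_single_right]
  ring

theorem fderiv_mem_TtildeSpan {u : E 4 → ℝ} (hu : u ∈ Ttilde) (s : Fin 4) :
    (fun x => fderiv ℝ u x (EuclideanSpace.single s 1)) ∈ TtildeSpan := by
  obtain ⟨l, k, i, m, p, hp, hl, hli, hmk, ⟨r, hr⟩, rfl⟩ := hu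
  obtain ⟨P, hP, rfl⟩ := hp.exists_isHomogeneous
  set a : ℝ := -(2 * (l : ℝ)) - k - m with ha
  have hX : (X s * P).IsHomogeneous (m + 1) := by
    rw [add_comm m]
    exact (isHomogeneous_X ℝ s).mul hP
  have ha2 : a - 2 = -(2 * (l : ℝ)) - (k + 1 : ℕ) - (m + 1 : ℕ) := by
    push_cast
    linarith
  have h1 : logTerm (a - 2) i (X s * P) ∈ TtildeSpan :=
    logTerm_mem hX hl (by lia) (by lia) ⟨r, by lia⟩ ha2
  have h2 : logTerm (a - 2) (i - 1) (X s * P) ∈ TtildeSpan :=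
    logTerm_mem hX hl (by lia) (by lia) ⟨r, by lia⟩ ha2
  have h3 : logTerm a i (pderiv s P) ∈ TtildeSpan := by
    obtain _ | m := m
    · rw [← totalDegree_zero_iff_isHomogeneous, totalDegree_eq_zero_iff_eq_C] at hP
      rw [hP, pderiv_C, map_zero]
      exact zero_mem _
    · refine logTerm_mem (k := k + 1) hP.pderiv hl (by lia) (by lia) ⟨r + 1, by lia⟩ ?_
      push_cast [Nat.add_sub_cancel] at ha ⊢
      linarith
  refine TtildeSpan.congr (add_mem (add_mem (TtildeSpan.smul_mem a h1)
    (TtildeSpan.smul_mem (i : ℝ) h2)) h3) fun x hx => ?_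
  exact fderiv_logTerm a i P hx s

theorem T2_subset_Ttilde : T2 4 ⊆ Ttilde := by
  rintro _ ⟨l, k, m, p, hp, hl, hlk, hmk, he, rfl⟩
  refine ⟨l, k, 0, m, p, hp, hl, hlk, hmk, he, funext fun x => ?_⟩
  rw [pow_zero, mul_one]
  congr 2
  push_cast
  ring

/-- properties of `𝒯̃` (on `ℝ⁴`):
`𝒯₂ ⊆ 𝒯̃`, `SPAN(𝒯̃)` is closed under pointwise multiplication (as functions on
`ℝ⁴∖{0}`), and partial derivatives of elements of `𝒯̃` lie in `SPAN(𝒯̃)`. -/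
theorem Ttilde_properties :
    T2 4 ⊆ Ttilde ∧
    (∀ u ∈ Submodule.span ℝ Ttilde, ∀ v ∈ Submodule.span ℝ Ttilde,
      ∃ w ∈ Submodule.span ℝ Ttilde, ∀ x : E 4, x ≠ 0 → u x * v x = w x) ∧
    (∀ u ∈ Ttilde, ∀ i : Fin 4, ∃ w ∈ Submodule.span ℝ Ttilde,
      ∀ x : E 4, x ≠ 0 → fderiv ℝ u x (EuclideanSpace.single i 1) = w x) := by
  exact ⟨T2_subset_Ttilde, fun u hu v hv =>
    let ⟨w, hw, h⟩ := TtildeSpan_mul_mem hu hv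
    ⟨w, hw, h⟩, fun u hu i => fderiv_mem_TtildeSpan hu i⟩
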